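/- arXiv:2105.00122 — 2 statements merged into one kernel-verified Lean document; each statement's English description precedes it below -/
import Mathlib

section
/- There exist a constant ε > 0 and a positive integer n₀ such that for every n ≥ n₀, every linear subspace V of 𝔽₃ⁿ that is a perfect 3-hash linear code has dimension at most (1/4 − ε)·n. -/
/-- A linear subspace `V ⊆ 𝔽₃ⁿ` is a perfect 3-hash linear code (trifferent) if for every
three pairwise distinct vectors `x, y, z ∈ V` there is a coordinate `i` with
`{x i, y i, z i} = {0, 1, 2} = ZMod 3`. -/
def Trifferent {n : ℕ} (V : Submodule (ZMod 3) (Fin n → ZMod 3)) : Prop :=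
  ∀ x ∈ V, ∀ y ∈ V, ∀ z ∈ V, x ≠ y → y ≠ z → x ≠ z →
    ∃ i : Fin n, ({x i, y i, z i} : Set (ZMod 3)) = Set.univ

open Finset MvPolynomial

/-- Every nonzero word of a trifferent linear code of dimension `k` has weight at least `2k - 1`. -/
theorem Trifferent.two_mul_finrank_le {n : ℕ} {V : Submodule (ZMod 3) (Fin n → ZMod 3)}
    (hV : Trifferent V) {w : Fin n → ZMod 3} (hw : w ∈ V) (hw0 : w ≠ 0) :
    2 * Module.finrank (ZMod 3) V ≤ hammingNorm w + 1 := by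
  have hsq : ∀ c : ZMod 3, c ≠ 0 → 1 + c * -c = 0 := by decide
  have key : ∀ p q : ZMod 3, (∀ r : ZMod 3, r = 0 ∨ r = p ∨ r = -q) →
      q ≠ 0 ∧ 1 + -q * p = 0 := by decide
  classical
  have : Fact (Nat.Prime 3) := ⟨by norm_num⟩
  set k := Module.finrank (ZMod 3) V with hk
  let e : V ≃ₗ[ZMod 3] (Fin k → ZMod 3) := (Module.finBasis (ZMod 3) V).equivFun
  let a : Fin n → Fin k → ZMod 3 := fun i j => (e.symm (Pi.single j 1) : V).1 i
  let L : Fin n → MvPolynomial (Fin k) (ZMod 3) := fun i => ∑ j, C (a i j) * X j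
  have hL : ∀ x i, eval x (L i) = (e.symm x : V).1 i := by
    intro x i
    have h := LinearMap.pi_apply_eq_sum_univ
      ((LinearMap.proj i).comp (V.subtype.comp e.symm.toLinearMap)) x
    simp only [LinearMap.comp_apply, LinearMap.proj_apply, Submodule.subtype_apply,
      LinearEquiv.coe_coe] at h
    rw [h]
    simp only [L, map_sum, map_mul, eval_C, eval_X, smul_eq_mul, a]
    refine Finset.sum_congr rfl fun j _ => ?_
    have hj : (fun l => if j = l then (1 : ZMod 3) else 0) = Pi.single j 1 := by
      funext l
      simp [Pi.single_apply, eq_comm]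
    rw [hj, mul_comm]
  have hLdeg : ∀ i, (L i).totalDegree ≤ 1 := by
    intro i
    refine totalDegree_finsetSum_le fun j _ => ?_
    refine (totalDegree_mul _ _).trans ?_
    simp
  have hfac : ∀ i (c : ZMod 3), (1 + C c * L i).totalDegree ≤ 1 := by
    intro i c
    refine (totalDegree_add _ _).trans (max_le (by simp) ((totalDegree_mul _ _).trans ?_))
    simpa using hLdeg i
  obtain ⟨i₀, hi₀⟩ : ∃ i, w i ≠ 0 := by
    by_contra! h
    exact hw0 (funext h)
  let P : MvPolynomial (Fin k) (ZMod 3) :=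
    (1 + C (w i₀) * L i₀) * ∏ i with w i ≠ 0, (1 + C (-w i) * L i)
  have hPdeg : P.totalDegree ≤ hammingNorm w + 1 := by
    refine (totalDegree_mul _ _).trans ?_
    have h1 : (∏ i with w i ≠ 0, (1 + C (-w i) * L i)).totalDegree ≤ hammingNorm w := by
      refine (totalDegree_finsetProd _ _).trans ?_
      refine (Finset.sum_le_sum fun i _ => hfac i _).trans ?_
      simp [hammingNorm]
    have := hfac i₀ (w i₀)
    omega
  have hP : ∀ x, x ≠ 0 → eval x P = 0 := by
    intro x hx
    simp only [P, map_mul, map_prod, map_add, map_one, eval_C, hL]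
    set u : V := e.symm x with hu
    have hu0 : u ≠ 0 := by simpa [hu] using hx
    by_cases huw : u.1 = -w
    · rw [huw]
      rw [Pi.neg_apply, hsq _ hi₀, zero_mul]
    · obtain ⟨i, hi⟩ := hV 0 V.zero_mem u.1 u.2 (-w) (V.neg_mem hw)
        (fun h => hu0 (Subtype.ext h.symm)) huw (fun h => hw0 (neg_eq_zero.mp h.symm))
      obtain ⟨h1, h2⟩ := key (u.1 i) (w i) fun r => by
        have : r ∈ ({(0 : Fin n → ZMod 3) i, u.1 i, (-w) i} : Set (ZMod 3)) := by
          rw [hi]; trivial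
        simpa using this
      rw [Finset.prod_eq_zero (Finset.mem_filter.mpr ⟨Finset.mem_univ i, h1⟩) h2, mul_zero]
  have hP0 : eval 0 P = 1 := by
    simp only [P, map_mul, map_prod, map_add, map_one, eval_C, hL]
    simp
  by_contra! hlt
  have hsum := MvPolynomial.sum_eval_eq_zero P (by
    rw [ZMod.card, Fintype.card_fin]
    omega)
  rw [Finset.sum_eq_single 0 (fun x _ hx => hP x hx) (by simp), hP0] at hsum
  exact one_ne_zero hsum

/-- Among the ternary labels `g v`, `v ∈ s`, the number of ordered pairs with distinct labels is
bounded in terms of the number of nonzero labels. -/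
theorem sum_ite_ne_le {α : Type*} (s : Finset α) (g : α → ZMod 3) :
    (∑ v ∈ s, ∑ w ∈ s, if g v ≠ g w then (1 : ℝ) else 0) ≤
      (#s : ℝ) ^ 2 / 6 + #s * ∑ v ∈ s, if g v ≠ 0 then (1 : ℝ) else 0 := by
  have hcases : ∀ p : ZMod 3, p = 0 ∨ p = 1 ∨ p = 2 := by decide
  have h02 : (0 : ZMod 3) ≠ 2 := by decide
  have h12 : (1 : ZMod 3) ≠ 2 := by decide
  let b : ZMod 3 → ℝ := fun j => ∑ v ∈ s, if g v = j then 1 else 0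
  have hb : b 0 + b 1 + b 2 = #s := by
    simp only [b, ← Finset.sum_add_distrib]
    rw [Finset.card_eq_sum_ones, Nat.cast_sum]
    refine Finset.sum_congr rfl fun v _ => ?_
    rcases hcases (g v) with h | h | h <;> simp [h, h02, h12, h02.symm, h12.symm]
  have h0 : (∑ v ∈ s, if g v ≠ 0 then (1 : ℝ) else 0) = b 1 + b 2 := by
    simp only [b, ← Finset.sum_add_distrib]
    refine Finset.sum_congr rfl fun v _ => ?_
    rcases hcases (g v) with h | h | h <;> simp [h, h02, h12, h02.symm, h12.symm]
  have h1 : (∑ v ∈ s, ∑ w ∈ s, if g v ≠ g w then (1 : ℝ) else 0) =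
      b 0 * (b 1 + b 2) + b 1 * (b 0 + b 2) + b 2 * (b 0 + b 1) := by
    simp only [b, ← Finset.sum_add_distrib, Finset.sum_mul_sum]
    refine Finset.sum_congr rfl fun v _ => Finset.sum_congr rfl fun w _ => ?_
    rcases hcases (g v) with h | h | h <;> rcases hcases (g w) with h' | h' | h' <;>
      simp [h, h', h02, h12, h02.symm, h12.symm]
  rw [h0, h1, ← hb]
  nlinarith [sq_nonneg (b 1 - b 2), sq_nonneg (b 0 - 2 * (b 1 + b 2))]

/-- Johnson bound for ternary words in a Hamming ball of radius `r` about the origin. -/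
theorem card_mul_le_of_hammingNorm_le {n r d : ℕ} (s : Finset (Fin n → ZMod 3))
    (hr : ∀ v ∈ s, hammingNorm v ≤ r)
    (hd : ∀ v ∈ s, ∀ w ∈ s, v ≠ w → d ≤ hammingDist v w) :
    (#s : ℝ) * (d - n / 6 - r) ≤ d := by
  classical
  rcases s.eq_empty_or_nonempty with rfl | hs
  · simp
  have hpos : (0 : ℝ) < #s := by exact_mod_cast hs.card_pos
  have hlow : (#s : ℝ) ^ 2 * d - #s * d ≤ ∑ v ∈ s, ∑ w ∈ s, (hammingDist v w : ℝ) := by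
    have : ∀ v ∈ s, ∀ w ∈ s, (d : ℝ) - (if v = w then (d : ℝ) else 0) ≤ hammingDist v w := by
      intro v hv w hw
      split_ifs with h
      · simp
      · simpa using hd v hv w hw h
    have hle : ∑ v ∈ s, ∑ w ∈ s, ((d : ℝ) - (if v = w then (d : ℝ) else 0)) ≤
        ∑ v ∈ s, ∑ w ∈ s, (hammingDist v w : ℝ) :=
      Finset.sum_le_sum fun v hv => Finset.sum_le_sum fun w hw => this v hv w hw
    refine le_trans (le_of_eq ?_) hle
    simp only [Finset.sum_sub_distrib, Finset.sum_const, nsmul_eq_mul, Finset.sum_ite_eq]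
    rw [Finset.sum_congr rfl fun v hv => show (if v ∈ s then (d : ℝ) else 0) = d from if_pos hv]
    simp only [Finset.sum_const, nsmul_eq_mul]
    ring
  have hup : ∑ v ∈ s, ∑ w ∈ s, (hammingDist v w : ℝ) ≤ (#s : ℝ) ^ 2 * (n / 6 + r) := by
    calc ∑ v ∈ s, ∑ w ∈ s, (hammingDist v w : ℝ)
        = ∑ i : Fin n, ∑ v ∈ s, ∑ w ∈ s, (if v i ≠ w i then (1 : ℝ) else 0) := by
          rw [eq_comm, Finset.sum_comm]
          refine Finset.sum_congr rfl fun v _ => ?_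
          rw [Finset.sum_comm]
          refine Finset.sum_congr rfl fun w _ => ?_
          simp only [hammingDist, Finset.sum_boole]
      _ ≤ ∑ i : Fin n, ((#s : ℝ) ^ 2 / 6 + #s * ∑ v ∈ s, if v i ≠ 0 then (1 : ℝ) else 0) :=
          Finset.sum_le_sum fun i _ => sum_ite_ne_le s fun v => v i
      _ = n * ((#s : ℝ) ^ 2 / 6) + #s * ∑ v ∈ s, (hammingNorm v : ℝ) := by
          rw [Finset.sum_add_distrib, ← Finset.mul_sum, Finset.sum_comm]
          simp only [hammingNorm, Finset.sum_boole, Finset.sum_const, card_univ, Fintype.card_fin,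
            nsmul_eq_mul]
      _ ≤ n * ((#s : ℝ) ^ 2 / 6) + #s * ∑ v ∈ s, (r : ℝ) := by
          gcongr with v hv
          exact_mod_cast hr v hv
      _ = (#s : ℝ) ^ 2 * (n / 6 + r) := by
          simp
          ring
  refine le_of_mul_le_mul_left ?_ hpos
  nlinarith

/-- The words of weight exactly `r` already give this lower bound for the size of a ball. -/
theorem choose_mul_two_pow_le_card (n r : ℕ) :
    n.choose r * 2 ^ r ≤ #{v : Fin n → ZMod 3 | hammingNorm v ≤ r} := by
  classical
  have hcard : #((powersetCard r (univ : Finset (Fin n))).sigma fun S => S.powerset) =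
      n.choose r * 2 ^ r := by
    rw [Finset.card_sigma, Finset.sum_congr rfl fun S hS => by
      rw [card_powerset, (mem_powersetCard.mp hS).2]]
    simp
  rw [← hcard]
  let f : (Σ _ : Finset (Fin n), Finset (Fin n)) → Fin n → ZMod 3 := fun p i =>
    if i ∈ p.2 then 2 else if i ∈ p.1 then 1 else 0
  have h20 : (2 : ZMod 3) ≠ 0 := by decide
  have h12 : (1 : ZMod 3) ≠ 2 := by decide
  have hsupp : ∀ p : (Σ _ : Finset (Fin n), Finset (Fin n)), p.2 ⊆ p.1 →
      ∀ i, f p i ≠ 0 ↔ i ∈ p.1 := by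
    intro p hp i
    have := @hp i
    simp only [f]
    split_ifs <;> simp_all
  have htwo : ∀ p : (Σ _ : Finset (Fin n), Finset (Fin n)), ∀ i, f p i = 2 ↔ i ∈ p.2 := by
    intro p i
    simp only [f]
    split_ifs <;> simp_all [h20.symm]
  refine Finset.card_le_card_of_injOn f ?_ ?_
  · intro p hp
    simp only [coe_sigma, Set.mem_sigma_iff, mem_coe, mem_powersetCard, mem_powerset] at hp
    simp only [coe_filter, mem_univ, true_and, Set.mem_ofPred_eq, hammingNorm,
      hsupp p hp.2, filter_univ_mem, hp.1.2, le_refl]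
  · intro p hp q hq hpq
    simp only [coe_sigma, Set.mem_sigma_iff, mem_coe, mem_powersetCard, mem_powerset] at hp hq
    have h1 : p.1 = q.1 := by
      ext i
      rw [← hsupp p hp.2, ← hsupp q hq.2, hpq]
    have h2 : p.2 = q.2 := by
      ext i
      rw [← htwo p, ← htwo q, hpq]
    cases p; cases q
    simp_all

theorem choose_mul_choose_le (a b c d : ℕ) :
    a.choose c * b.choose d ≤ (a + b).choose (c + d) := by
  rw [Nat.add_choose_eq]
  exact Finset.single_le_sum (f := fun ij : ℕ × ℕ => a.choose ij.1 * b.choose ij.2)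
    (fun _ _ => Nat.zero_le _) (a := (c, d)) (by simp)

theorem choose_pow_le (a c m : ℕ) : a.choose c ^ m ≤ (a * m).choose (c * m) := by
  induction m with
  | zero => simp
  | succ m ih =>
    rw [pow_succ, Nat.mul_succ, Nat.mul_succ]
    exact (Nat.mul_le_mul_right _ ih).trans (choose_mul_choose_le _ _ _ _)

theorem three_pow_le_card (n : ℕ) :
    3 ^ (76 * (n / 100)) ≤ #{v : Fin n → ZMod 3 | hammingNorm v ≤ 33 * (n / 100)} := by
  have hnum : 3 ^ 76 ≤ Nat.choose 100 33 * 2 ^ 33 := by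
    norm_num [Nat.choose_eq_factorial_div_factorial, Nat.factorial]
  calc 3 ^ (76 * (n / 100)) = (3 ^ 76) ^ (n / 100) := pow_mul _ _ _
    _ ≤ (Nat.choose 100 33 * 2 ^ 33) ^ (n / 100) := Nat.pow_le_pow_left hnum _
    _ = Nat.choose 100 33 ^ (n / 100) * 2 ^ (33 * (n / 100)) := by rw [mul_pow, ← pow_mul]
    _ ≤ n.choose (33 * (n / 100)) * 2 ^ (33 * (n / 100)) := by
        refine Nat.mul_le_mul_right _ ((choose_pow_le _ _ _).trans ?_)
        exact Nat.choose_le_choose _ (Nat.mul_div_le n 100)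
    _ ≤ _ := choose_mul_two_pow_le_card _ _

/-- Some translate of `A` meets `B` in at least the average number of points. -/
theorem exists_card_mul_card_le {G : Type*} [AddCommGroup G] [Fintype G] [DecidableEq G]
    (A B : Finset G) : ∃ x, #A * #B ≤ Fintype.card G * #{b ∈ B | b + x ∈ A} := by
  have hsum : ∑ x, #{b ∈ B | b + x ∈ A} = #A * #B := by
    simp only [Finset.card_filter]
    rw [Finset.sum_comm, Finset.sum_congr rfl fun b _ =>
      show ∑ x, (if b + x ∈ A then 1 else 0) = ∑ y, (if y ∈ A then 1 else 0) from
      Equiv.sum_comp (Equiv.addLeft b) fun y => if y ∈ A then 1 else 0]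
    simp [mul_comm]
  obtain ⟨x, -, hx⟩ := Finset.exists_le_of_sum_le (s := (univ : Finset G))
    (f := fun _ => #A * #B) (g := fun x => Fintype.card G * #{b ∈ B | b + x ∈ A})
    univ_nonempty (by rw [← Finset.mul_sum (f := fun x => #{b ∈ B | b + x ∈ A}), hsum]; simp)
  exact ⟨x, hx⟩

theorem perfect_3hash_linear_dimension_bound :
    ∃ ε : ℝ, 0 < ε ∧ ∃ n₀ : ℕ, 0 < n₀ ∧
      ∀ n : ℕ, n₀ ≤ n →
        ∀ V : Submodule (ZMod 3) (Fin n → ZMod 3), Trifferent V →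
          (Module.finrank (ZMod 3) V : ℝ) ≤ (1/4 - ε) * n := by
  refine ⟨1 / 1000, by norm_num, 10000, by norm_num, fun n hn V hV => ?_⟩
  classical
  have : Fact (Nat.Prime 3) := ⟨by norm_num⟩
  by_contra! hlt
  set k := Module.finrank (ZMod 3) V with hk
  set m := n / 100 with hm
  have hnR : (10000 : ℝ) ≤ n := by exact_mod_cast hn
  have hmn : 100 * (m : ℝ) ≤ n := by exact_mod_cast Nat.mul_div_le n 100
  have hmn' : (n : ℝ) ≤ 100 * m + 99 := by
    have : n ≤ 100 * m + 99 := by omega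
    exact_mod_cast this
  let A : Finset (Fin n → ZMod 3) := {v | v ∈ V}
  have hA : #A = 3 ^ k := by
    have h := Module.card_eq_pow_finrank (K := ZMod 3) (V := V)
    rw [ZMod.card] at h
    rw [← h, Fintype.card_subtype]
  obtain ⟨x, hx⟩ := exists_card_mul_card_le A {v | hammingNorm v ≤ 33 * m}
  set s : Finset (Fin n → ZMod 3) :=
    {b ∈ ({v | hammingNorm v ≤ 33 * m} : Finset (Fin n → ZMod 3)) | b + x ∈ A} with hs
  have hJ := card_mul_le_of_hammingNorm_le (r := 33 * m) (d := 2 * k - 1) s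
    (fun v hv => by simpa using (Finset.mem_filter.mp hv).1) (by
      intro v hv w hw hvw
      have hv' : v + x ∈ V := by simpa [A] using (Finset.mem_filter.mp hv).2
      have hw' : w + x ∈ V := by simpa [A] using (Finset.mem_filter.mp hw).2
      have hmem : -v + w ∈ V := by
        convert V.sub_mem hw' hv' using 1
        abel
      have := hV.two_mul_finrank_le hmem (by rwa [ne_eq, neg_add_eq_zero])
      rw [hammingDist_eq_hammingNorm]
      omega)
  have hk1 : 1 ≤ 2 * k := by
    have : (0 : ℝ) < k := by nlinarith
    have : 0 < k := by exact_mod_cast this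
    omega
  rw [Nat.cast_sub hk1] at hJ
  push_cast at hJ
  have hkn : (k : ℝ) ≤ n := by
    have h : k ≤ n := by simpa using Submodule.finrank_le V
    exact_mod_cast h
  have hsR : (#s : ℝ) ≤ 2000 := by
    by_contra! hbig
    nlinarith
  have hs7 : #s ≤ 3 ^ 7 := by
    have : #s ≤ 2000 := by exact_mod_cast hsR
    omega
  have hpow : 3 ^ (k + 76 * m) ≤ 3 ^ (n + 7) := by
    calc 3 ^ (k + 76 * m) = #A * 3 ^ (76 * m) := by rw [hA, pow_add]
      _ ≤ _ := Nat.mul_le_mul_left _ (three_pow_le_card n)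
      _ ≤ _ := hx
      _ ≤ 3 ^ n * 3 ^ 7 := by
          refine Nat.mul_le_mul (by simp [ZMod.card]) hs7
      _ = 3 ^ (n + 7) := (pow_add _ _ _).symm
  have hexp : k + 76 * m ≤ n + 7 := (Nat.pow_le_pow_iff_right (by norm_num)).mp hpow
  have hexpR : (k : ℝ) + 76 * m ≤ n + 7 := by exact_mod_cast hexp
  linarith
end

section
/- Let V ⊆ 𝔽₃ⁿ be a d-dimensional linear subspace that is a perfect 3-hash linear code. Then d ≤ (n + 11)/4. -/
/-- A codeword `c` of maximal weight in a linear code: for every codeword `b` and scalar `a`, the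
number of coordinates where `b` is nonzero outside the support of `c` is at most the number of
coordinates of the support of `c` where `b + a • c` vanishes. -/
lemma card_outside_support_le {ι K : Type*} [Fintype ι] [Field K] [DecidableEq K]
    {V : Submodule K (ι → K)} {b c : ι → K} (hb : b ∈ V) (hc : c ∈ V)
    (hmax : ∀ x ∈ V, hammingNorm x ≤ hammingNorm c) (a : K) :
    (Finset.univ.filter fun i => c i = 0 ∧ b i ≠ 0).card ≤
      (Finset.univ.filter fun i => c i ≠ 0 ∧ b i + a * c i = 0).card := by
  classical
  have hle := hmax _ (V.add_mem hb (V.smul_mem a hc))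
  have hdisj : Disjoint (Finset.univ.filter fun i => c i = 0 ∧ b i ≠ 0)
      (Finset.univ.filter fun i => c i ≠ 0) := by
    rw [Finset.disjoint_filter]
    tauto
  have hsub : (Finset.univ.filter fun i => c i = 0 ∧ b i ≠ 0) ∪
      (Finset.univ.filter fun i => c i ≠ 0) ⊆
      (Finset.univ.filter fun i => (b + a • c) i ≠ 0) ∪
        (Finset.univ.filter fun i => c i ≠ 0 ∧ b i + a * c i = 0) := by
    intro i
    simp only [Finset.mem_union, Finset.mem_filter, Finset.mem_univ, true_and, Pi.add_apply,
      Pi.smul_apply, smul_eq_mul]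
    rintro (⟨h0, h1⟩ | h)
    · left
      simpa [h0] using h1
    · tauto
  have h1 := Finset.card_le_card hsub
  have h2 := Finset.card_union_le (Finset.univ.filter fun i => (b + a • c) i ≠ 0)
    (Finset.univ.filter fun i => c i ≠ 0 ∧ b i + a * c i = 0)
  rw [Finset.card_union_of_disjoint hdisj] at h1
  unfold hammingNorm at hle
  omega

/-- If every codeword supported in the support of `c` is a multiple of `c`, then some codeword has
at least `finrank V - 1` nonzero coordinates outside the support of `c`. -/
lemma exists_finrank_le_card_outside_support {ι K : Type*} [Fintype ι] [Field K] [Finite K]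
    [DecidableEq K] (V : Submodule K (ι → K)) (c : ι → K)
    (hc : ∀ w ∈ V, (∀ i, c i = 0 → w i = 0) → w ∈ Submodule.span K {c}) :
    ∃ b ∈ V, Module.finrank K V ≤
      (Finset.univ.filter fun i => c i = 0 ∧ b i ≠ 0).card + 1 := by
  classical
  obtain ⟨b, hb, hmax⟩ := Set.exists_max_image (V : Set (ι → K))
    (fun b => (Finset.univ.filter fun i => c i = 0 ∧ b i ≠ 0).card) (Set.toFinite _)
    ⟨0, V.zero_mem⟩
  refine ⟨b, hb, ?_⟩
  by_contra! hlt
  set T := Finset.univ.filter fun i => c i = 0 ∧ b i ≠ 0 with hT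
  let f : V →ₗ[K] (T → K) := (LinearMap.funLeft K K (Subtype.val : T → ι)).domRestrict V
  have hrank := f.finrank_range_add_finrank_ker
  have hrange : Module.finrank K (LinearMap.range f) ≤ T.card := by
    simpa using Submodule.finrank_le (LinearMap.range f)
  have hker : ¬ (LinearMap.ker f).map V.subtype ≤ Submodule.span K {c} := by
    intro hle
    have h1 := Submodule.finrank_mono hle
    have h2 : Module.finrank K (Submodule.span K {c}) ≤ 1 := by
      simpa using finrank_span_le_card (R := K) ({c} : Set (ι → K))
    rw [Submodule.finrank_map_subtype_eq] at h1
    omega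
  apply hker
  rintro _ ⟨w, hw, rfl⟩
  have hwT : ∀ i, c i = 0 → b i ≠ 0 → w.1 i = 0 := fun i h0 h1 =>
    congrFun (LinearMap.mem_ker.mp hw) ⟨i, by simp [hT, h0, h1]⟩
  refine hc _ w.2 fun j hj => ?_
  by_contra hwj
  have hsub : T ⊂ Finset.univ.filter fun i => c i = 0 ∧ (b + w.1) i ≠ 0 := by
    rw [Finset.ssubset_iff_of_subset]
    · refine ⟨j, ?_, ?_⟩
      · have hbj : b j = 0 := by
          by_contra h
          exact hwj (hwT j hj h)
        simpa [hj, hbj] using hwj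
      · intro h
        exact hwj (hwT j hj (by simpa [hT, hj] using h))
    · intro i hi
      obtain ⟨h0, h1⟩ : c i = 0 ∧ b i ≠ 0 := by simpa [hT] using hi
      simp [h0, h1, hwT i h0 h1]
  exact (Finset.card_lt_card hsub).not_ge (hmax _ (V.add_mem hb w.2))

/-- Trifferent linear codes are minimal: a codeword supported in the support of another codeword
is a multiple of it. -/
lemma Trifferent.mem_span_of_support_subset {n : ℕ} {V : Submodule (ZMod 3) (Fin n → ZMod 3)}
    (hV : Trifferent V) {c w : Fin n → ZMod 3} (hc : c ∈ V) (hw : w ∈ V)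
    (hsupp : ∀ i, c i = 0 → w i = 0) : w ∈ Submodule.span (ZMod 3) {c} := by
  by_contra hspan
  have hne : ∀ a : ZMod 3, w ≠ a • c := fun a h =>
    hspan (h ▸ Submodule.smul_mem _ a (Submodule.mem_span_singleton_self c))
  obtain ⟨i, hi⟩ := hV 0 V.zero_mem (c + w) (V.add_mem hc hw) (c - w) (V.sub_mem hc hw)
    (fun h => hne (-1) (by rw [neg_one_smul]; exact (neg_eq_of_add_eq_zero_right h.symm).symm))
    (fun h => hne 0 (by
      ext i
      have h' := congrFun h i
      simp only [Pi.add_apply, Pi.sub_apply, Pi.smul_apply, zero_smul] at h' ⊢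
      revert h'
      generalize c i = x
      generalize w i = y
      revert x y
      decide))
    (fun h => hne 1 (by rw [one_smul]; exact (sub_eq_zero.mp h.symm).symm))
  have h1 : (1 : ZMod 3) ∈ ({0, c i + w i, c i - w i} : Set (ZMod 3)) := by
    have := Set.mem_univ (1 : ZMod 3)
    rwa [← hi] at this
  have h2 : (2 : ZMod 3) ∈ ({0, c i + w i, c i - w i} : Set (ZMod 3)) := by
    have := Set.mem_univ (2 : ZMod 3)
    rwa [← hi] at this
  have h0 := hsupp i
  simp only [Set.mem_insert_iff, Set.mem_singleton_iff] at h1 h2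
  revert h0 h1 h2
  generalize c i = x
  generalize w i = y
  revert x y
  decide

/-- A trifferent linear code of length `n` and dimension `d` satisfies `4 (d - 1) ≤ n`. -/
lemma Trifferent.four_mul_finrank_le {n : ℕ} {V : Submodule (ZMod 3) (Fin n → ZMod 3)}
    (hV : Trifferent V) : 4 * Module.finrank (ZMod 3) V ≤ n + 4 := by
  obtain ⟨c, hc, hmax⟩ := Set.exists_max_image (V : Set (Fin n → ZMod 3)) hammingNorm
    (Set.toFinite _) ⟨0, V.zero_mem⟩
  obtain ⟨b, hb, hdim⟩ := exists_finrank_le_card_outside_support V c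
    fun w hw => hV.mem_span_of_support_subset hc hw
  set M := Finset.univ.filter fun i => c i = 0 ∧ b i ≠ 0
  let A : ZMod 3 → Finset (Fin n) := fun a =>
    Finset.univ.filter fun i => c i ≠ 0 ∧ b i + a * c i = 0
  have hA : ∀ a, M.card ≤ (A a).card := card_outside_support_le hb hc hmax
  have hAA : ((Finset.univ : Finset (ZMod 3)) : Set (ZMod 3)).PairwiseDisjoint A := by
    intro a _ a' _ haa'
    refine Finset.disjoint_filter.mpr fun i _ h h' => haa' ?_
    exact mul_right_cancel₀ h.1 (add_left_cancel (h.2.trans h'.2.symm))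
  have hMA : Disjoint M (Finset.univ.biUnion A) := by
    refine (Finset.disjoint_biUnion_right _ _ _).mpr fun a _ => ?_
    exact Finset.disjoint_filter.mpr fun i _ h h' => h'.1 h.1
  have hsum : 3 * M.card ≤ ∑ a, (A a).card := by
    simpa using Finset.card_nsmul_le_sum Finset.univ (fun a => (A a).card) _ fun a _ => hA a
  have htotal := Finset.card_le_univ (M ∪ Finset.univ.biUnion A)
  rw [Finset.card_union_of_disjoint hMA, Finset.card_biUnion hAA, Fintype.card_fin] at htotal
  omega

theorem perfect_3hash_linear_dim_le (n d : ℕ)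
    (V : Submodule (ZMod 3) (Fin n → ZMod 3))
    (hdim : Module.finrank (ZMod 3) V = d)
    (hV : Trifferent V) :
    (d : ℝ) ≤ (n + 11) / 4 := by
  have h : (4 * d : ℝ) ≤ n + 4 := by
    have := hV.four_mul_finrank_le
    rw [hdim] at this
    exact_mod_cast this
  linarith
end
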